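/- Let (a_n)_{n≥1} and (b_n)_{n≥1} be sequences of positive integers such that a_n ≤ r α^{n^l} and s₁ β₁^{n^{k₁}} ≤ b_n ≤ s₂ β₂^{n^{k₂}} for all n ≥ 1, where l is a non-negative real number, r, s₁, s₂, β₂, k₁, k₂ are positive real numbers, 1 ≤ α < β₁, and k₁ + 1 > k₂ ≥ k₁. If l = k₁, then the generalized continued fraction K_{n=1}^∞ a_n/b_n converges to an irrational number τ with μ_I(τ) ≤ 2 + (log α)/(log β₁ − log α). -/

import Mathlib

open Filter Real

/-- The asymptotic irrationality exponent: the infimum (in `EReal`, so that the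
infimum of the empty set is `∞`) of all real `μ` for which there exist `c > 0`
and `N₀ > 0` with `|τ - M/N| ≥ c / N ^ μ` for all integers `M, N` with `N ≥ N₀`. -/
noncomputable def muI (τ : ℝ) : EReal :=
  sInf ((fun μ : ℝ => (μ : EReal)) ''
    {μ : ℝ | ∃ c > (0:ℝ), ∃ N₀ > (0:ℝ), ∀ M N : ℤ,
      (N : ℝ) ≥ N₀ → |τ - (M : ℝ) / (N : ℝ)| ≥ c / (N : ℝ) ^ μ})

/-- Numerators of the convergents of the generalized continued fraction
`K_{n=1}^∞ a n / b n`. -/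
def cfA (a b : ℕ → ℤ) : ℕ → ℤ
  | 0 => 0
  | 1 => a 1
  | (n + 2) => b (n + 2) * cfA a b (n + 1) + a (n + 2) * cfA a b n

/-- Denominators of the convergents of the generalized continued fraction
`K_{n=1}^∞ a n / b n`. -/
def cfB (a b : ℕ → ℤ) : ℕ → ℤ
  | 0 => 1
  | 1 => b 1
  | (n + 2) => b (n + 2) * cfB a b (n + 1) + a (n + 2) * cfB a b n

theorem cfB_pos {a b : ℕ → ℤ} (ha0 : ∀ n, 1 ≤ n → 0 < a n) (hb0 : ∀ n, 1 ≤ n → 0 < b n) (n : ℕ) :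
    0 < cfB a b n := by
  induction n using Nat.twoStepInduction with
  | zero => simp [cfB]
  | one => simpa [cfB] using hb0 1 le_rfl
  | more n h1 h2 =>
    rw [cfB]
    exact add_pos (mul_pos (hb0 _ (by omega)) h2) (mul_pos (ha0 _ (by omega)) h1)

theorem cfB_le_succ {a b : ℕ → ℤ} (ha0 : ∀ n, 1 ≤ n → 0 < a n) (hb0 : ∀ n, 1 ≤ n → 0 < b n)
    (n : ℕ) : cfB a b n ≤ cfB a b (n + 1) := by
  cases n with
  | zero => exact hb0 1 le_rfl
  | succ n =>
    have h0 := cfB_pos ha0 hb0 n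
    have h1 := cfB_pos ha0 hb0 (n + 1)
    have := hb0 (n + 2) (by omega)
    have := ha0 (n + 2) (by omega)
    rw [cfB.eq_3]
    nlinarith

theorem prod_le_cfB {a b : ℕ → ℤ} (ha0 : ∀ n, 1 ≤ n → 0 < a n) (hb0 : ∀ n, 1 ≤ n → 0 < b n)
    (n : ℕ) : ∏ i ∈ Finset.range n, b (i + 1) ≤ cfB a b n := by
  induction n with
  | zero => simp [cfB]
  | succ n ih =>
    cases n with
    | zero => simp [cfB]
    | succ n =>
      rw [Finset.prod_range_succ, cfB]
      have := mul_le_mul_of_nonneg_right ih (hb0 (n + 2) (by omega)).le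
      have := mul_pos (ha0 (n + 2) (by omega)) (cfB_pos ha0 hb0 n)
      linarith

theorem cfB_le_prod {a b : ℕ → ℤ} (ha0 : ∀ n, 1 ≤ n → 0 < a n) (hb0 : ∀ n, 1 ≤ n → 0 < b n)
    {K : ℝ} (hK : 0 ≤ K) (hab : ∀ n, 1 ≤ n → (a n : ℝ) ≤ K * b n) (n : ℕ) :
    (cfB a b n : ℝ) ≤ (1 + K) ^ n * ∏ i ∈ Finset.range n, (b (i + 1) : ℝ) := by
  induction n with
  | zero => simp [cfB]
  | succ n ih =>
    cases n with
    | zero =>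
      have : (0 : ℝ) < b 1 := by exact_mod_cast hb0 1 le_rfl
      simp only [cfB, zero_add, pow_one, Finset.prod_range_one]
      nlinarith
    | succ n =>
      rw [Finset.prod_range_succ, cfB, pow_succ]
      push_cast
      have hb : (0 : ℝ) < b (n + 2) := by exact_mod_cast hb0 (n + 2) (by omega)
      have hB : (0 : ℝ) < cfB a b n := by exact_mod_cast cfB_pos ha0 hb0 n
      have hBs : (cfB a b n : ℝ) ≤ cfB a b (n + 1) := by exact_mod_cast cfB_le_succ ha0 hb0 n
      calc (b (n + 2) : ℝ) * cfB a b (n + 1) + a (n + 2) * cfB a b n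
          ≤ b (n + 2) * cfB a b (n + 1) + (K * b (n + 2)) * cfB a b (n + 1) := by
            gcongr
            exact hab _ (by omega)
        _ = (1 + K) * b (n + 2) * cfB a b (n + 1) := by ring
        _ ≤ (1 + K) * b (n + 2) *
            ((1 + K) ^ (n + 1) * ∏ i ∈ Finset.range (n + 1), (b (i + 1) : ℝ)) := by
          gcongr
        _ = _ := by ring_nf

theorem cfA_succ_mul_cfB_sub (a b : ℕ → ℤ) (n : ℕ) :
    cfA a b (n + 1) * cfB a b n - cfA a b n * cfB a b (n + 1) =
      (-1) ^ n * ∏ i ∈ Finset.range (n + 1), a (i + 1) := by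
  induction n with
  | zero => simp [cfA, cfB]
  | succ n ih =>
    rw [Finset.prod_range_succ, pow_succ, cfA.eq_3, cfB.eq_3]
    linear_combination (-a (n + 2)) * ih

/-- The distance between consecutive convergents. -/
noncomputable def cfGap (a b : ℕ → ℤ) (n : ℕ) : ℝ :=
  (∏ i ∈ Finset.range (n + 1), (a (i + 1) : ℝ)) / (cfB a b n * cfB a b (n + 1))

theorem cfGap_antitone {a b : ℕ → ℤ} (ha0 : ∀ n, 1 ≤ n → 0 < a n)
    (hb0 : ∀ n, 1 ≤ n → 0 < b n) : Antitone (cfGap a b) := by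
  refine antitone_nat_of_succ_le fun n => ?_
  have h0 : (0 : ℝ) < cfB a b n := by exact_mod_cast cfB_pos ha0 hb0 n
  have h1 : (0 : ℝ) < cfB a b (n + 1) := by exact_mod_cast cfB_pos ha0 hb0 (n + 1)
  have h2 : (0 : ℝ) < cfB a b (n + 2) := by exact_mod_cast cfB_pos ha0 hb0 (n + 2)
  have hP : (0 : ℝ) < ∏ i ∈ Finset.range (n + 1), (a (i + 1) : ℝ) :=
    Finset.prod_pos fun i _ => by exact_mod_cast ha0 (i + 1) (by omega)
  have hb : (0 : ℝ) < b (n + 2) := by exact_mod_cast hb0 (n + 2) (by omega)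
  have hrec : (cfB a b (n + 2) : ℝ) = b (n + 2) * cfB a b (n + 1) + a (n + 2) * cfB a b n := by
    exact_mod_cast cfB.eq_3 a b n
  have key : (a (n + 2) : ℝ) * cfB a b n ≤ cfB a b (n + 2) := by nlinarith
  unfold cfGap
  rw [Finset.prod_range_succ, div_le_div_iff₀ (by positivity) (by positivity)]
  have := mul_le_mul_of_nonneg_left key (mul_pos hP h1).le
  calc _ = (∏ i ∈ Finset.range (n + 1), (a (i + 1) : ℝ)) * cfB a b (n + 1) *
        (a (n + 2) * cfB a b n) := by ring_nf
    _ ≤ _ := this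
    _ = _ := by ring_nf

theorem cfA_div_cfB_eq_sum {a b : ℕ → ℤ} (ha0 : ∀ n, 1 ≤ n → 0 < a n)
    (hb0 : ∀ n, 1 ≤ n → 0 < b n) (n : ℕ) :
    (cfA a b n : ℝ) / cfB a b n = ∑ i ∈ Finset.range n, (-1) ^ i * cfGap a b i := by
  induction n with
  | zero => simp [cfA]
  | succ n ih =>
    have h0 : (0 : ℝ) < cfB a b n := by exact_mod_cast cfB_pos ha0 hb0 n
    have h1 : (0 : ℝ) < cfB a b (n + 1) := by exact_mod_cast cfB_pos ha0 hb0 (n + 1)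
    have hdet : (cfA a b (n + 1) : ℝ) * cfB a b n - cfA a b n * cfB a b (n + 1) =
      (-1) ^ n * ∏ i ∈ Finset.range (n + 1), (a (i + 1) : ℝ) := by
      exact_mod_cast cfA_succ_mul_cfB_sub a b n
    rw [Finset.sum_range_succ, ← ih, cfGap, ← mul_div_assoc, ← hdet]
    field_simp
    ring

theorem cfB_mul_cfGap_le {a b : ℕ → ℤ} (ha0 : ∀ n, 1 ≤ n → 0 < a n)
    (hb0 : ∀ n, 1 ≤ n → 0 < b n) (n : ℕ) :
    cfB a b n * cfGap a b n ≤ (∏ i ∈ Finset.range (n + 1), (b (i + 1) : ℝ) / a (i + 1))⁻¹ := by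
  have h0 : (0 : ℝ) < cfB a b n := by exact_mod_cast cfB_pos ha0 hb0 n
  have hP : (0 : ℝ) < ∏ i ∈ Finset.range (n + 1), (a (i + 1) : ℝ) :=
    Finset.prod_pos fun i _ => by exact_mod_cast ha0 (i + 1) (by omega)
  have hR : (0 : ℝ) < ∏ i ∈ Finset.range (n + 1), (b (i + 1) : ℝ) :=
    Finset.prod_pos fun i _ => by exact_mod_cast hb0 (i + 1) (by omega)
  have h1 : ∏ i ∈ Finset.range (n + 1), (b (i + 1) : ℝ) ≤ cfB a b (n + 1) := by
    exact_mod_cast prod_le_cfB ha0 hb0 (n + 1)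
  have : cfB a b n * cfGap a b n =
      (∏ i ∈ Finset.range (n + 1), (a (i + 1) : ℝ)) / cfB a b (n + 1) := by
    have := hR.trans_le h1
    unfold cfGap
    field_simp
  rw [this, Finset.prod_div_distrib, inv_div]
  gcongr

theorem exists_tendsto_cfA_div_cfB {a b : ℕ → ℤ} (ha0 : ∀ n, 1 ≤ n → 0 < a n)
    (hb0 : ∀ n, 1 ≤ n → 0 < b n)
    (hQ : Tendsto (fun n => ∏ i ∈ Finset.range n, (b (i + 1) : ℝ) / a (i + 1)) atTop atTop) :
    ∃ τ : ℝ, Tendsto (fun n => (cfA a b n : ℝ) / (cfB a b n : ℝ)) atTop (nhds τ) ∧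
      ∀ n, |cfB a b n * τ - cfA a b n| ≤
        (∏ i ∈ Finset.range (n + 1), (b (i + 1) : ℝ) / a (i + 1))⁻¹ := by
  have hanti := cfGap_antitone ha0 hb0
  have hB : ∀ n, (1 : ℝ) ≤ cfB a b n := fun n => by exact_mod_cast cfB_pos ha0 hb0 n
  have hnn : ∀ n, 0 ≤ cfGap a b n := fun n => by
    have h0 := hB n
    have h1 := hB (n + 1)
    have hP : (0 : ℝ) < ∏ i ∈ Finset.range (n + 1), (a (i + 1) : ℝ) :=
      Finset.prod_pos fun i _ => by exact_mod_cast ha0 (i + 1) (by omega)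
    unfold cfGap
    positivity
  have hzero : Tendsto (cfGap a b) atTop (nhds 0) :=
    squeeze_zero hnn
      (fun n => (le_mul_of_one_le_left (hnn n) (hB n)).trans (cfB_mul_cfGap_le ha0 hb0 n))
      (tendsto_inv_atTop_zero.comp ((tendsto_add_atTop_iff_nat 1).2 hQ))
  obtain ⟨τ, hτ⟩ := hanti.tendsto_alternating_series_of_tendsto_zero hzero
  refine ⟨τ, by simpa only [cfA_div_cfB_eq_sum ha0 hb0] using hτ, fun n => ?_⟩
  have hdist : |τ - (cfA a b n : ℝ) / cfB a b n| ≤ cfGap a b n := by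
    rw [cfA_div_cfB_eq_sum ha0 hb0, abs_le]
    obtain ⟨k, rfl | rfl⟩ := n.even_or_odd'
    · have h1 := hanti.alternating_series_le_tendsto hτ k
      have h2 := hanti.tendsto_le_alternating_series hτ k
      rw [Finset.sum_range_succ, (even_two_mul k).neg_one_pow] at h2
      have := hnn (2 * k)
      constructor <;> linarith
    · have h1 := hanti.alternating_series_le_tendsto hτ (k + 1)
      have h2 := hanti.tendsto_le_alternating_series hτ k
      rw [mul_add, mul_one, Finset.sum_range_succ, (odd_two_mul_add_one k).neg_one_pow] at h1
      have := hnn (2 * k + 1)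
      constructor <;> linarith
  refine le_trans ?_ (cfB_mul_cfGap_le ha0 hb0 n)
  have h0 : (0 : ℝ) < cfB a b n := by linarith [hB n]
  have : cfB a b n * τ - cfA a b n = cfB a b n * (τ - cfA a b n / cfB a b n) := by
    field_simp
  rw [this, abs_mul, abs_of_pos h0]
  gcongr

theorem inv_le_abs_of_cf_approx {a b : ℕ → ℤ} (ha0 : ∀ n, 1 ≤ n → 0 < a n)
    (hb0 : ∀ n, 1 ≤ n → 0 < b n) {τ : ℝ} {n : ℕ} {M N : ℤ} (hN : 0 < N)
    (h0 : |cfB a b n * τ - cfA a b n| ≤ (2 * N : ℝ)⁻¹)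
    (h1 : |cfB a b (n + 1) * τ - cfA a b (n + 1)| ≤ (2 * N : ℝ)⁻¹) :
    (2 * cfB a b (n + 1) : ℝ)⁻¹ ≤ |N * τ - M| := by
  have hNR : (0 : ℝ) < N := by exact_mod_cast hN
  have main : ∀ m, |cfB a b m * τ - cfA a b m| ≤ (2 * N : ℝ)⁻¹ →
      cfB a b m ≤ cfB a b (n + 1) → cfA a b m * N - M * cfB a b m ≠ 0 →
      (2 * cfB a b (n + 1) : ℝ)⁻¹ ≤ |N * τ - M| := by
    intro m hm hle hne
    have hB : (0 : ℝ) < cfB a b m := by exact_mod_cast cfB_pos ha0 hb0 m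
    have hleR : (cfB a b m : ℝ) ≤ cfB a b (n + 1) := by exact_mod_cast hle
    have hone : (1 : ℝ) ≤ |(cfA a b m : ℝ) * N - M * cfB a b m| := by
      exact_mod_cast Int.one_le_abs hne
    have htri : |(cfA a b m : ℝ) * N - M * cfB a b m| ≤
        cfB a b m * |N * τ - M| + N * |cfB a b m * τ - cfA a b m| := by
      have : (cfA a b m : ℝ) * N - M * cfB a b m =
        cfB a b m * (N * τ - M) - N * (cfB a b m * τ - cfA a b m) := by ring
      rw [this]
      refine (abs_sub _ _).trans ?_
      rw [abs_mul, abs_mul, abs_of_pos hB, abs_of_pos hNR]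
    have hhalf : N * |cfB a b m * τ - cfA a b m| ≤ 1 / 2 := by
      calc N * |cfB a b m * τ - cfA a b m| ≤ N * (2 * N : ℝ)⁻¹ := by gcongr
        _ = 1 / 2 := by field_simp
    calc (2 * cfB a b (n + 1) : ℝ)⁻¹ ≤ (2 * cfB a b m : ℝ)⁻¹ := by gcongr
      _ ≤ |N * τ - M| := by
        rw [inv_le_iff_one_le_mul₀ (by positivity)]
        nlinarith
  by_cases hne : cfA a b n * N - M * cfB a b n = 0
  · refine main (n + 1) h1 le_rfl fun hne' => ?_
    have hdet := cfA_succ_mul_cfB_sub a b n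
    have hP : 0 < ∏ i ∈ Finset.range (n + 1), a (i + 1) :=
      Finset.prod_pos fun i _ => ha0 (i + 1) (by omega)
    have hz : (cfA a b (n + 1) * cfB a b n - cfA a b n * cfB a b (n + 1)) * N = 0 := by
      linear_combination cfB a b n * hne' - cfB a b (n + 1) * hne
    rw [hdet] at hz
    simp [hP.ne', hN.ne'] at hz
  · exact main n h0 (cfB_le_succ ha0 hb0 n) hne

theorem exists_irrationality_measure {a b : ℕ → ℤ} (ha0 : ∀ n, 1 ≤ n → 0 < a n)
    (hb0 : ∀ n, 1 ≤ n → 0 < b n)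
    (hQ : Tendsto (fun n => ∏ i ∈ Finset.range n, (b (i + 1) : ℝ) / a (i + 1)) atTop atTop)
    (hab : ∀ᶠ n in atTop, a n ≤ b n) {τ : ℝ}
    (hτ : ∀ n, |cfB a b n * τ - cfA a b n| ≤
        (∏ i ∈ Finset.range (n + 1), (b (i + 1) : ℝ) / a (i + 1))⁻¹)
    {ν : ℝ} (hν : 0 ≤ ν)
    (hB : ∀ᶠ n in atTop, (cfB a b (n + 1) : ℝ) ≤
      (∏ i ∈ Finset.range n, (b (i + 1) : ℝ) / a (i + 1)) ^ ν) :
    ∃ c > (0:ℝ), ∃ N₀ > (0:ℝ), ∀ M N : ℤ,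
      (N : ℝ) ≥ N₀ → |τ - (M : ℝ) / (N : ℝ)| ≥ c / (N : ℝ) ^ (1 + ν) := by
  set Q : ℕ → ℝ := fun n => ∏ i ∈ Finset.range n, (b (i + 1) : ℝ) / a (i + 1) with hQdef
  have hapos : ∀ n : ℕ, (0 : ℝ) < a (n + 1) := fun n => by exact_mod_cast ha0 (n + 1) (by omega)
  have hbpos : ∀ n : ℕ, (0 : ℝ) < b (n + 1) := fun n => by exact_mod_cast hb0 (n + 1) (by omega)
  have hQpos : ∀ n, 0 < Q n := fun n => Finset.prod_pos fun i _ => div_pos (hbpos i) (hapos i)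
  obtain ⟨n₀, hn₀⟩ := eventually_atTop.1 (hab.and hB)
  refine ⟨(2 * 2 ^ ν)⁻¹, by positivity, Q n₀, hQpos _, fun M N hN => ?_⟩
  have hNR : (0 : ℝ) < N := (hQpos _).trans_le hN
  have hN0 : 0 < N := by exact_mod_cast hNR
  have hex : ∃ m, n₀ ≤ m ∧ 2 * (N : ℝ) < Q (m + 1) := by
    obtain ⟨m, hm⟩ := (((tendsto_add_atTop_iff_nat 1).2 hQ).eventually_gt_atTop (2 * (N : ℝ))
      |>.and (eventually_ge_atTop n₀)).exists
    exact ⟨m, hm.2, hm.1⟩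
  classical
  obtain ⟨n, ⟨hn, hlt⟩, hmin⟩ : ∃ n, (n₀ ≤ n ∧ 2 * (N : ℝ) < Q (n + 1)) ∧
      ∀ m < n, ¬ (n₀ ≤ m ∧ 2 * (N : ℝ) < Q (m + 1)) :=
    ⟨Nat.find hex, Nat.find_spec hex, fun m hm => Nat.find_min hex hm⟩
  have hle : Q n ≤ 2 * N := by
    rcases hn.eq_or_lt with rfl | hlt'
    · linarith
    · obtain ⟨m, rfl⟩ := Nat.exists_eq_add_of_lt hlt'
      by_contra! hcon
      exact hmin (n₀ + m) (by omega) ⟨by omega, hcon⟩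
  have hmono : Q (n + 1) ≤ Q (n + 2) := by
    rw [show Q (n + 2) = Q (n + 1) * (b (n + 1 + 1) / a (n + 1 + 1)) from
      Finset.prod_range_succ _ _]
    refine le_mul_of_one_le_right (hQpos _).le ?_
    rw [one_le_div (hapos _)]
    exact_mod_cast (hn₀ (n + 1 + 1) (by omega)).1
  have key := inv_le_abs_of_cf_approx (M := M) ha0 hb0 hN0
    ((hτ n).trans (inv_anti₀ (by positivity) hlt.le))
    ((hτ (n + 1)).trans (inv_anti₀ (by positivity) (hlt.le.trans hmono)))
  have hBpos : (0 : ℝ) < cfB a b (n + 1) := by exact_mod_cast cfB_pos ha0 hb0 (n + 1)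
  have hBle : (cfB a b (n + 1) : ℝ) ≤ 2 ^ ν * (N : ℝ) ^ ν := by
    rw [← Real.mul_rpow (by norm_num) hNR.le]
    exact ((hn₀ n hn).2).trans (Real.rpow_le_rpow (hQpos n).le hle hν)
  have heq : |τ - (M : ℝ) / N| = |N * τ - M| / N := by
    rw [eq_div_iff hNR.ne']
    nth_rw 2 [← abs_of_pos hNR]
    rw [← abs_mul]
    congr 1
    field_simp
  rw [ge_iff_le, heq, Real.rpow_add hNR, Real.rpow_one]
  calc (2 * 2 ^ ν)⁻¹ / ((N : ℝ) * (N : ℝ) ^ ν) = (2 * (2 ^ ν * (N : ℝ) ^ ν))⁻¹ / N := by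
        field_simp
    _ ≤ (2 * cfB a b (n + 1) : ℝ)⁻¹ / N := by gcongr
    _ ≤ _ := by gcongr

theorem irrational_of_irrationality_measure {τ μ : ℝ}
    (h : ∃ c > (0:ℝ), ∃ N₀ > (0:ℝ), ∀ M N : ℤ,
      (N : ℝ) ≥ N₀ → |τ - (M : ℝ) / (N : ℝ)| ≥ c / (N : ℝ) ^ μ) : Irrational τ := by
  obtain ⟨c, hc, N₀, hN₀, h⟩ := h
  rintro ⟨q, rfl⟩
  obtain ⟨k, hk⟩ := exists_nat_gt N₀
  have hkpos : (0 : ℝ) < k := hN₀.trans hk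
  have hd : (1 : ℝ) ≤ q.den := by exact_mod_cast q.den_pos
  have hkd : (k : ℝ) ≤ k * q.den := le_mul_of_one_le_right hkpos.le hd
  have := h (k * q.num) (k * q.den) (by push_cast; linarith)
  have hz : (q : ℝ) - ((k * q.num : ℤ) : ℝ) / ((k * q.den : ℤ) : ℝ) = 0 := by
    push_cast
    rw [mul_div_mul_left _ _ hkpos.ne', sub_eq_zero]
    exact_mod_cast (Rat.num_div_den q).symm
  rw [hz, abs_zero] at this
  have hpos : (0 : ℝ) < ((k * q.den : ℤ) : ℝ) := by push_cast; linarith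
  have : 0 < c / ((k * q.den : ℤ) : ℝ) ^ μ := by positivity
  linarith

theorem rpow_le_sum_rpow {k : ℝ} (hk : 0 ≤ k) (n : ℕ) :
    (n : ℝ) ^ (k + 1) ≤ (k + 1) * ∑ i ∈ Finset.range n, ((i + 1 : ℕ) : ℝ) ^ k := by
  induction n with
  | zero => simp [Real.zero_rpow (by linarith : k + 1 ≠ 0)]
  | succ n ih =>
    rw [Finset.sum_range_succ, mul_add]
    have hpos : (0 : ℝ) < ((n + 1 : ℕ) : ℝ) := by positivity
    have hbern := one_add_mul_self_le_rpow_one_add (s := -(1 / ((n + 1 : ℕ) : ℝ)))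
      (p := k + 1) (by
        rw [neg_le_neg_iff, div_le_one hpos]
        push_cast
        linarith [n.cast_nonneg (α := ℝ)]) (by linarith)
    have hfrac : (1 + -(1 / ((n + 1 : ℕ) : ℝ))) = n / ((n + 1 : ℕ) : ℝ) := by
      field_simp
      push_cast
      ring
    rw [hfrac, Real.div_rpow (by positivity) hpos.le, le_div_iff₀ (by positivity)] at hbern
    have hsplit : ((n + 1 : ℕ) : ℝ) ^ (k + 1) = ((n + 1 : ℕ) : ℝ) ^ k * ((n + 1 : ℕ) : ℝ) := by
      rw [Real.rpow_add hpos, Real.rpow_one]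
    have : (1 + (k + 1) * -(1 / ((n + 1 : ℕ) : ℝ))) * ((n + 1 : ℕ) : ℝ) ^ (k + 1) =
        ((n + 1 : ℕ) : ℝ) ^ (k + 1) - (k + 1) * ((n + 1 : ℕ) : ℝ) ^ k := by
      rw [hsplit]
      field_simp
      ring
    linarith

theorem eventually_le_sum_rpow {k k' : ℝ} (hk : 0 < k) (hk' : k' < k + 1) (hk'0 : 0 < k')
    (C₀ C₁ C₂ : ℝ) {ε : ℝ} (hε : 0 < ε) :
    ∀ᶠ n : ℕ in atTop, C₀ + C₁ * n + C₂ * ((n + 1 : ℕ) : ℝ) ^ k' ≤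
      ε * ∑ i ∈ Finset.range n, ((i + 1 : ℕ) : ℝ) ^ k := by
  have hlt : ∀ p < k + 1, (fun n : ℕ => (n : ℝ) ^ p) =o[atTop] fun n : ℕ => (n : ℝ) ^ (k + 1) :=
    fun p hp => by
      have hpos : ∀ᶠ n : ℕ in atTop, (0 : ℝ) < n :=
        (eventually_gt_atTop 0).mono fun n hn => by exact_mod_cast hn
      refine (Asymptotics.isLittleO_iff_tendsto' (hpos.mono fun n hn h =>
        absurd h (Real.rpow_pos_of_pos hn _).ne')).2 ?_
      refine ((tendsto_rpow_neg_atTop (sub_pos.2 hp)).comp tendsto_natCast_atTop_atTop).congr' ?_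
      filter_upwards [hpos] with n hn
      rw [Function.comp_apply, neg_sub, Real.rpow_sub hn]
  have h0 := (hlt 0 (by linarith)).const_mul_left C₀
  have h1 := (hlt 1 (by linarith)).const_mul_left C₁
  have h2 := (hlt k' hk').const_mul_left (|C₂| * 2 ^ k')
  have hsum := ((h0.add h1).add h2).bound (show 0 < ε / (k + 1) by positivity)
  filter_upwards [hsum, eventually_ge_atTop 1] with n hn hn1
  have hn1' : (1 : ℝ) ≤ n := by exact_mod_cast hn1
  have hb := (le_abs_self _).trans hn
  rw [Real.norm_of_nonneg (by positivity : (0 : ℝ) ≤ (n : ℝ) ^ (k + 1)), Real.rpow_zero,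
    Real.rpow_one, mul_one] at hb
  have hshift : C₂ * ((n + 1 : ℕ) : ℝ) ^ k' ≤ |C₂| * 2 ^ k' * (n : ℝ) ^ k' := by
    rw [mul_assoc, ← Real.mul_rpow (by norm_num) (by positivity)]
    have : ((n + 1 : ℕ) : ℝ) ^ k' ≤ (2 * (n : ℝ)) ^ k' := by
      apply Real.rpow_le_rpow (by positivity) _ hk'0.le
      push_cast
      linarith
    calc C₂ * ((n + 1 : ℕ) : ℝ) ^ k' ≤ |C₂| * ((n + 1 : ℕ) : ℝ) ^ k' := by
          gcongr
          exact le_abs_self _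
      _ ≤ _ := by gcongr
  have hS := rpow_le_sum_rpow hk.le n
  calc _ ≤ ε / (k + 1) * (n : ℝ) ^ (k + 1) := by linarith
    _ ≤ ε / (k + 1) * ((k + 1) * ∑ i ∈ Finset.range n, ((i + 1 : ℕ) : ℝ) ^ k) := by gcongr
    _ = _ := by field_simp

/-- exponential growth, case `l = k₁`.  If `a_n ≤ r α^{n^l}` and
`s₁ β₁^{n^{k₁}} ≤ b_n ≤ s₂ β₂^{n^{k₂}}` with `1 ≤ α < β₁`, `k₁ + 1 > k₂ ≥ k₁`
and `l = k₁`, then the continued fraction converges to an irrational `τ` with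
`μ_I(τ) ≤ 2 + log α / (log β₁ - log α)`. -/
theorem gcf_muI_le_of_exponential_growth_eq_case
    (a b : ℕ → ℤ) (ha0 : ∀ n, 1 ≤ n → 0 < a n) (hb0 : ∀ n, 1 ≤ n → 0 < b n)
    (l r s₁ s₂ α β₁ β₂ k₁ k₂ : ℝ)
    (hl : 0 ≤ l) (hr : 0 < r) (hs₁ : 0 < s₁) (hs₂ : 0 < s₂)
    (hα : 1 ≤ α) (hαβ : α < β₁) (hβ₂ : 0 < β₂)
    (hk₁ : 0 < k₁) (hk₂ : 0 < k₂) (hk : k₁ + 1 > k₂) (hkk : k₂ ≥ k₁)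
    (hlk : l = k₁)
    (ha : ∀ n : ℕ, 1 ≤ n → (a n : ℝ) ≤ r * α ^ ((n : ℝ) ^ l))
    (hb : ∀ n : ℕ, 1 ≤ n →
      s₁ * β₁ ^ ((n : ℝ) ^ k₁) ≤ (b n : ℝ) ∧ (b n : ℝ) ≤ s₂ * β₂ ^ ((n : ℝ) ^ k₂)) :
    ∃ τ : ℝ,
      Tendsto (fun n => (cfA a b n : ℝ) / (cfB a b n : ℝ)) atTop (nhds τ) ∧
      Irrational τ ∧
      muI τ ≤ ((2 + Real.log α / (Real.log β₁ - Real.log α) : ℝ) : EReal) := by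
  subst hlk
  set L := Real.log β₁ with hL
  set A := Real.log α with hA
  have hα0 : 0 < α := by linarith
  have hβ0 : 0 < β₁ := by linarith
  have hA0 : 0 ≤ A := Real.log_nonneg hα
  have hAL : 0 < L - A := sub_pos.2 (Real.log_lt_log hα0 hαβ)
  have haR : ∀ n, 1 ≤ n → (0 : ℝ) < a n := fun n hn => by exact_mod_cast ha0 n hn
  have hbR : ∀ n, 1 ≤ n → (0 : ℝ) < b n := fun n hn => by exact_mod_cast hb0 n hn
  have hloga : ∀ n : ℕ, 1 ≤ n → Real.log (a n) ≤ Real.log r + (n : ℝ) ^ l * A := fun n hn => by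
    have := Real.log_le_log (haR n hn) (ha n hn)
    rwa [Real.log_mul hr.ne' (by positivity), Real.log_rpow hα0] at this
  have hlogb : ∀ n : ℕ, 1 ≤ n → Real.log s₁ + (n : ℝ) ^ l * L ≤ Real.log (b n) := fun n hn => by
    have := Real.log_le_log (by positivity) (hb n hn).1
    rwa [Real.log_mul hs₁.ne' (by positivity), Real.log_rpow hβ0] at this
  have hlogb' : ∀ n : ℕ, 1 ≤ n →
      Real.log (b n) ≤ Real.log s₂ + (n : ℝ) ^ k₂ * Real.log β₂ := fun n hn => by
    have := Real.log_le_log (hbR n hn) (hb n hn).2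
    rwa [Real.log_mul hs₂.ne' (by positivity), Real.log_rpow hβ₂] at this
  set S : ℕ → ℝ := fun n => ∑ i ∈ Finset.range n, ((i + 1 : ℕ) : ℝ) ^ l with hS
  set X : ℕ → ℝ := fun n => ∑ i ∈ Finset.range n, Real.log (b (i + 1)) with hX
  set Q : ℕ → ℝ := fun n => ∏ i ∈ Finset.range n, (b (i + 1) : ℝ) / a (i + 1) with hQdef
  have hQpos : ∀ n, 0 < Q n := fun n =>
    Finset.prod_pos fun i _ => div_pos (hbR _ (by omega)) (haR _ (by omega))
  have hXlow : ∀ n, n * Real.log s₁ + S n * L ≤ X n := fun n => by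
    have := Finset.sum_le_sum fun i (_ : i ∈ Finset.range n) => hlogb (i + 1) (by omega)
    rwa [Finset.sum_add_distrib, ← Finset.sum_mul, Finset.sum_const, Finset.card_range,
      nsmul_eq_mul] at this
  have hlogQ : ∀ n, X n - (n * Real.log r + S n * A) ≤ Real.log (Q n) := fun n => by
    have := Finset.sum_le_sum fun i (_ : i ∈ Finset.range n) => hloga (i + 1) (by omega)
    rw [Finset.sum_add_distrib, ← Finset.sum_mul, Finset.sum_const, Finset.card_range,
      nsmul_eq_mul] at this
    have hlog : Real.log (Q n) = X n - ∑ i ∈ Finset.range n, Real.log (a (i + 1)) := by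
      rw [hQdef, Real.log_prod fun i _ =>
        (div_pos (hbR (i + 1) (by omega)) (haR (i + 1) (by omega))).ne', hX,
        ← Finset.sum_sub_distrib]
      exact Finset.sum_congr rfl fun i _ =>
        Real.log_div (hbR (i + 1) (by omega)).ne' (haR (i + 1) (by omega)).ne'
    linarith
  have hlogQ' : ∀ n, n * (Real.log s₁ - Real.log r) + S n * (L - A) ≤ Real.log (Q n) := fun n => by
    linarith [hXlow n, hlogQ n]
  have hQ : Tendsto Q atTop atTop := by
    have : Tendsto (fun n => Real.log (Q n)) atTop atTop := by
      refine tendsto_atTop.2 fun C => ?_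
      filter_upwards [eventually_le_sum_rpow hk₁ hk hk₂ C (Real.log r - Real.log s₁) 0 hAL]
        with n hn
      have := hlogQ' n
      linarith
    exact (Real.tendsto_exp_atTop.comp this).congr fun n => Real.exp_log (hQpos n)
  have hab : ∀ᶠ n in atTop, a n ≤ b n := by
    have ht : Tendsto (fun n : ℕ => (n : ℝ) ^ l * (L - A)) atTop atTop :=
      ((tendsto_rpow_atTop hk₁).comp tendsto_natCast_atTop_atTop).atTop_mul_const hAL
    filter_upwards [ht.eventually_ge_atTop (Real.log r - Real.log s₁), eventually_ge_atTop 1]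
      with n hn hn1
    have : Real.log (a n) ≤ Real.log (b n) := by linarith [hloga n hn1, hlogb n hn1]
    exact_mod_cast (Real.log_le_log_iff (haR n hn1) (hbR n hn1)).1 this
  have hratio : ∀ n, 1 ≤ n → (a n : ℝ) ≤ r / s₁ * b n := fun n hn => by
    calc (a n : ℝ) ≤ r * α ^ ((n : ℝ) ^ l) := ha n hn
      _ ≤ r * β₁ ^ ((n : ℝ) ^ l) := by gcongr
      _ = r / s₁ * (s₁ * β₁ ^ ((n : ℝ) ^ l)) := by field_simp
      _ ≤ r / s₁ * b n := by
        gcongr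
        exact (hb n hn).1
  have hlogB : ∀ n, Real.log (cfB a b n) ≤ n * Real.log (1 + r / s₁) + X n := fun n => by
    have hBpos : (0 : ℝ) < cfB a b n := by exact_mod_cast cfB_pos ha0 hb0 n
    have hR : ∏ i ∈ Finset.range n, (b (i + 1) : ℝ) ≠ 0 :=
      Finset.prod_ne_zero_iff.2 fun i _ => (hbR (i + 1) (by omega)).ne'
    have := Real.log_le_log hBpos (cfB_le_prod ha0 hb0 (by positivity) hratio n)
    rwa [Real.log_mul (by positivity) hR, Real.log_pow,
      Real.log_prod fun i _ => (hbR (i + 1) (by omega)).ne'] at this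
  have hB : ∀ δ > 0, ∀ᶠ n in atTop, (cfB a b (n + 1) : ℝ) ≤ Q n ^ (1 + A / (L - A) + δ) := by
    intro δ hδ
    set θ := A / (L - A) with hθ
    have hθ0 : 0 ≤ θ := by positivity
    have hθL : θ * (L - A) = A := by
      rw [hθ]
      field_simp
    set D := Real.log (1 + r / s₁) with hD
    filter_upwards [eventually_le_sum_rpow hk₁ hk hk₂ (D + Real.log s₂)
      (D + Real.log r - θ * (Real.log s₁ - Real.log r) - δ * (Real.log s₁ - Real.log r))
      (Real.log β₂) (mul_pos hδ hAL)] with n hn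
    have hBpos : (0 : ℝ) < cfB a b (n + 1) := by exact_mod_cast cfB_pos ha0 hb0 (n + 1)
    rw [← Real.log_le_log_iff hBpos (Real.rpow_pos_of_pos (hQpos n) _), Real.log_rpow (hQpos n)]
    have h1 := hlogB (n + 1)
    have h2 := hlogb' (n + 1) (by omega)
    have h3 : X (n + 1) = X n + Real.log (b (n + 1)) := Finset.sum_range_succ _ _
    have h4 := hlogQ n
    have h5 := mul_le_mul_of_nonneg_left (hlogQ' n) hθ0
    have h6 := mul_le_mul_of_nonneg_left (hlogQ' n) hδ.le
    have h7 : θ * (n * (Real.log s₁ - Real.log r) + S n * (L - A)) =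
        n * (θ * (Real.log s₁ - Real.log r)) + S n * A := by
      linear_combination S n * hθL
    rw [Nat.cast_succ] at h1
    linarith
  obtain ⟨τ, hτ, hτB⟩ := exists_tendsto_cfA_div_cfB ha0 hb0 hQ
  have hmeas : ∀ δ > 0, ∃ c > (0:ℝ), ∃ N₀ > (0:ℝ), ∀ M N : ℤ,
      (N : ℝ) ≥ N₀ → |τ - (M : ℝ) / (N : ℝ)| ≥ c / (N : ℝ) ^ (1 + (1 + A / (L - A) + δ)) :=
    fun δ hδ => exists_irrationality_measure ha0 hb0 hQ hab hτB (by positivity) (hB δ hδ)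
  refine ⟨τ, hτ, irrational_of_irrationality_measure (hmeas 1 one_pos), ?_⟩
  refine EReal.le_of_forall_lt_iff_le.1 fun z hz => sInf_le ⟨z, ?_, rfl⟩
  have hz' := EReal.coe_lt_coe_iff.1 hz
  have := hmeas (z - (2 + A / (L - A))) (sub_pos.2 hz')
  rwa [show 1 + (1 + A / (L - A) + (z - (2 + A / (L - A)))) = z by ring] at this
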